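/- If a state τ ∈ Ω has no monochromatic cross (neither a green cross nor a red cross), then τ has a fault line (horizontal or vertical). -/

import Mathlib

open Finset

/-! Six-vertex model on the `n × n` square lattice region `Λ_n` with free
boundary conditions.

`Edge.horiz k j` is the horizontal edge between `x = k-1` and `x = k` at
height `j`; `Edge.vert i k` is the vertical edge between `y = k-1` and
`y = k` on column `i`.  The vertices of `Λ_n` are the pairs
`(i, j) : Fin n × Fin n`.  An edge configuration assigns `true`
(rightwards / upwards) or `false` (leftwards / downwards) to every edge. -/
inductive Edge (n : ℕ) : Type
  | horiz (k : Fin (n + 1)) (j : Fin n) : Edge n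
  | vert (i : Fin n) (k : Fin (n + 1)) : Edge n
  deriving DecidableEq, Fintype

abbrev EdgeConfig (n : ℕ) := Edge n → Bool

/-- The four edges incident to the vertex `(i, j)` of `Λ_n`. -/
def leftE {n : ℕ} (i j : Fin n) : Edge n := Edge.horiz i.castSucc j
def rightE {n : ℕ} (i j : Fin n) : Edge n := Edge.horiz i.succ j
def botE {n : ℕ} (i j : Fin n) : Edge n := Edge.vert i j.castSucc
def topE {n : ℕ} (i j : Fin n) : Edge n := Edge.vert i j.succ

/-- The in-degree of the vertex `(i, j)` in the configuration `τ`. -/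
def inDegree {n : ℕ} (τ : EdgeConfig n) (i j : Fin n) : ℕ :=
  (cond (τ (leftE i j)) 1 0) + (cond (τ (rightE i j)) 0 1) +
    (cond (τ (botE i j)) 1 0) + (cond (τ (topE i j)) 0 1)

/-- The ice rule: every vertex has exactly two incoming (and hence two
outgoing) incident edges; such a configuration is an Eulerian orientation. -/
def IceRule {n : ℕ} (τ : EdgeConfig n) : Prop :=
  ∀ i j : Fin n, inDegree τ i j = 2

instance {n : ℕ} (τ : EdgeConfig n) : Decidable (IceRule τ) :=
  inferInstanceAs (Decidable (∀ i j : Fin n, inDegree τ i j = 2))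

/-- `Ω`, the state space: all Eulerian orientations of `Λ_n`. -/
def OmegaSet (n : ℕ) : Set (EdgeConfig n) := {τ | IceRule τ}

/-- The state `τ_G`, in which every vertex has six-vertex type `c`. -/
def greenOrient {n : ℕ} : Edge n → Bool
  | Edge.horiz k j => (k.val + j.val) % 2 == 0
  | Edge.vert i k => (i.val + k.val) % 2 == 1

def tauG (n : ℕ) : EdgeConfig n := greenOrient

/-- The state `τ_R`, the total edge reversal of `τ_G`. -/
def tauR (n : ℕ) : EdgeConfig n := fun e => !(greenOrient e)

/-- An edge is green in `τ` if it is oriented as in `τ_G`, red otherwise. -/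
def greenB {n : ℕ} (τ : EdgeConfig n) (e : Edge n) : Bool := τ e == greenOrient e

def IsGreen {n : ℕ} (τ : EdgeConfig n) (e : Edge n) : Prop := τ e = greenOrient e
def IsRed {n : ℕ} (τ : EdgeConfig n) (e : Edge n) : Prop := τ e = !(greenOrient e)

/-- Incidence between edges and vertices of `Λ_n`. -/
def EdgeIncident {n : ℕ} : Edge n → Fin n × Fin n → Prop
  | Edge.horiz k j', (i, j) => j' = j ∧ (k = i.castSucc ∨ k = i.succ)
  | Edge.vert i' k, (i, j) => i' = i ∧ (k = j.castSucc ∨ k = j.succ)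

/-- Two (distinct) edges are adjacent if they share an incident `Λ_n`-vertex. -/
def EdgeAdj {n : ℕ} (e f : Edge n) : Prop :=
  e ≠ f ∧ ∃ v : Fin n × Fin n, EdgeIncident e v ∧ EdgeIncident f v

/-- A simple (self-avoiding) monochromatic path of edges of colour `g`
(`true` = green, `false` = red). -/
def MonoPath {n : ℕ} (τ : EdgeConfig n) (g : Bool) (p : List (Edge n)) : Prop :=
  p ≠ [] ∧ p.Nodup ∧ List.Chain' EdgeAdj p ∧ ∀ e ∈ p, greenB τ e = g

/-- A horizontal monochromatic bridge: a simple monochromatic path from a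
horizontal edge on the left boundary to a horizontal edge on the right
boundary of `Λ_n`. -/
def IsHorizBridge {n : ℕ} (τ : EdgeConfig n) (g : Bool) (p : List (Edge n)) : Prop :=
  MonoPath τ g p ∧ (∃ j, p.head? = some (Edge.horiz 0 j)) ∧
    (∃ j, p.getLast? = some (Edge.horiz (Fin.last n) j))

/-- A vertical monochromatic bridge, from the top boundary to the bottom. -/
def IsVertBridge {n : ℕ} (τ : EdgeConfig n) (g : Bool) (p : List (Edge n)) : Prop :=
  MonoPath τ g p ∧ (∃ i, p.head? = some (Edge.vert i (Fin.last n))) ∧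
    (∃ i, p.getLast? = some (Edge.vert i 0))

def HorizGreenBridge {n : ℕ} (τ : EdgeConfig n) : Prop := ∃ p, IsHorizBridge τ true p
def HorizRedBridge {n : ℕ} (τ : EdgeConfig n) : Prop := ∃ p, IsHorizBridge τ false p
def VertGreenBridge {n : ℕ} (τ : EdgeConfig n) : Prop := ∃ p, IsVertBridge τ true p
def VertRedBridge {n : ℕ} (τ : EdgeConfig n) : Prop := ∃ p, IsVertBridge τ false p

def HasGreenCross {n : ℕ} (τ : EdgeConfig n) : Prop :=
  HorizGreenBridge τ ∧ VertGreenBridge τ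

def HasRedCross {n : ℕ} (τ : EdgeConfig n) : Prop :=
  HorizRedBridge τ ∧ VertRedBridge τ

/-- `C_G`: the states with a green cross. -/
def CG (n : ℕ) : Set (EdgeConfig n) := {τ | IceRule τ ∧ HasGreenCross τ}

/-- `C_R`: the states with a red cross. -/
def CR (n : ℕ) : Set (EdgeConfig n) := {τ | IceRule τ ∧ HasRedCross τ}

/-! The shifted lattice `L = ℤ² + (1/2, 1/2)`, restricted to the region inside
`Λ_n`.  The `L_n`-vertex `(i, j) : Fin (n+1) × Fin (n+1)` represents the point
`(i - 1/2, j - 1/2)`; its boundary vertices are those with a coordinate equal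
to `0` or `n`.  An `L_n`-edge is a diagonal passing through exactly one
`Λ_n`-vertex; it is recorded as that `Λ_n`-vertex together with a Boolean
(`true` for the NE–SW diagonal, `false` for the NW–SE diagonal). -/
abbrev LVertex (n : ℕ) := Fin (n + 1) × Fin (n + 1)

abbrev LEdge (n : ℕ) := (Fin n × Fin n) × Bool

/-- The two `L_n`-endpoints of an `L_n`-edge. -/
def lEdgeEnds {n : ℕ} : LEdge n → LVertex n × LVertex n
  | ((i, j), true) => ((i.castSucc, j.castSucc), (i.succ, j.succ))
  | ((i, j), false) => ((i.succ, j.castSucc), (i.castSucc, j.succ))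

/-- The `L_n`-edge `e` joins the `L_n`-vertices `u` and `v`. -/
def StepOnEdge {n : ℕ} (e : LEdge n) (u v : LVertex n) : Prop :=
  lEdgeEnds e = (u, v) ∨ lEdgeEnds e = (v, u)

/-- Adjacency in the lattice `L_n`. -/
def LAdjacent {n : ℕ} (u v : LVertex n) : Prop :=
  ∃ e : LEdge n, StepOnEdge e u v

/-- Membership of an `L_n`-edge in `L_τ`: the four `Λ_n`-edges incident to the
`Λ_n`-vertex it passes through are two green and two red, and the edge
separates the two green edges from the two red ones. -/
def lTau {n : ℕ} (τ : EdgeConfig n) : LEdge n → Bool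
  | ((i, j), true) =>
      (greenB τ (leftE i j) == greenB τ (topE i j)) &&
        (greenB τ (rightE i j) == greenB τ (botE i j)) &&
        !(greenB τ (leftE i j) == greenB τ (rightE i j))
  | ((i, j), false) =>
      (greenB τ (leftE i j) == greenB τ (botE i j)) &&
        (greenB τ (rightE i j) == greenB τ (topE i j)) &&
        !(greenB τ (leftE i j) == greenB τ (rightE i j))

/-- A step between two `L_n`-vertices along an edge of `L_τ`. -/
def LStep {n : ℕ} (τ : EdgeConfig n) (u v : LVertex n) : Prop :=
  ∃ e : LEdge n, StepOnEdge e u v ∧ lTau τ e = true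

/-- The consecutive steps of a path given as a list of vertices. -/
def pathSteps {α : Type*} (p : List α) : List (α × α) := p.zip p.tail

/-- A vertical fault line: a self-avoiding path of `L_τ`-edges from an
`L_n`-vertex on the top boundary to an `L_n`-vertex on the bottom boundary. -/
def IsVertFaultLine {n : ℕ} (τ : EdgeConfig n) (p : List (LVertex n)) : Prop :=
  p ≠ [] ∧ p.Nodup ∧ List.Chain' (LStep τ) p ∧
    (∃ u, p.head? = some u ∧ u.2 = Fin.last n) ∧
    (∃ u, p.getLast? = some u ∧ u.2 = 0)

/-- A horizontal fault line: from the left boundary to the right boundary. -/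
def IsHorizFaultLine {n : ℕ} (τ : EdgeConfig n) (p : List (LVertex n)) : Prop :=
  p ≠ [] ∧ p.Nodup ∧ List.Chain' (LStep τ) p ∧
    (∃ u, p.head? = some u ∧ u.1 = 0) ∧
    (∃ u, p.getLast? = some u ∧ u.1 = Fin.last n)

def HasVertFaultLine {n : ℕ} (τ : EdgeConfig n) : Prop := ∃ p, IsVertFaultLine τ p
def HasHorizFaultLine {n : ℕ} (τ : EdgeConfig n) : Prop := ∃ p, IsHorizFaultLine τ p

/-- `C_FL`: the states with a (horizontal or vertical) fault line. -/
def CFL (n : ℕ) : Set (EdgeConfig n) :=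
  {τ | IceRule τ ∧ (HasHorizFaultLine τ ∨ HasVertFaultLine τ)}

/-- A vertical almost fault line: a self-avoiding `L_n`-path from the top
boundary to the bottom boundary all of whose edges except exactly one
belong to `L_τ`. -/
def IsVertAlmostFaultLine {n : ℕ} (τ : EdgeConfig n) (p : List (LVertex n)) : Prop :=
  p ≠ [] ∧ p.Nodup ∧ List.Chain' LAdjacent p ∧
    (∃ u, p.head? = some u ∧ u.2 = Fin.last n) ∧
    (∃ u, p.getLast? = some u ∧ u.2 = 0) ∧
    ∃ s ∈ pathSteps p, ¬ LStep τ s.1 s.2 ∧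
      ∀ t ∈ pathSteps p, t ≠ s → LStep τ t.1 t.2

/-- A horizontal almost fault line. -/
def IsHorizAlmostFaultLine {n : ℕ} (τ : EdgeConfig n) (p : List (LVertex n)) : Prop :=
  p ≠ [] ∧ p.Nodup ∧ List.Chain' LAdjacent p ∧
    (∃ u, p.head? = some u ∧ u.1 = 0) ∧
    (∃ u, p.getLast? = some u ∧ u.1 = Fin.last n) ∧
    ∃ s ∈ pathSteps p, ¬ LStep τ s.1 s.2 ∧
      ∀ t ∈ pathSteps p, t ≠ s → LStep τ t.1 t.2

/-- `C_AFL`: the states with an almost fault line. -/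
def CAFL (n : ℕ) : Set (EdgeConfig n) :=
  {τ | IceRule τ ∧
    ((∃ p, IsHorizAlmostFaultLine τ p) ∨ (∃ p, IsVertAlmostFaultLine τ p))}

/-- The weight of the vertex `(i, j)`: `c` for the two `c`-type configurations
(both horizontal edges in, or both out), and `a` or `b` for the others. -/
noncomputable def vertexWeight {n : ℕ} (a b c : ℝ) (τ : EdgeConfig n)
    (i j : Fin n) : ℝ :=
  if τ (leftE i j) ≠ τ (rightE i j) then c
  else if τ (leftE i j) = τ (botE i j) then a else b

/-- The weight `w(τ)` of a state: the product of the vertex weights. -/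
noncomputable def weight {n : ℕ} (a b c : ℝ) (τ : EdgeConfig n) : ℝ :=
  ∏ v : Fin n × Fin n, vertexWeight a b c τ v.1 v.2

/-- The partition function `Z`. -/
noncomputable def Zsum (n : ℕ) (a b c : ℝ) : ℝ :=
  ∑ τ ∈ Finset.univ.filter (fun τ : EdgeConfig n => IceRule τ), weight a b c τ

open Classical in
/-- The Gibbs measure of a set of states, `π(S) = (Σ_{τ∈S} w(τ))/Z`. -/
noncomputable def piSet (n : ℕ) (a b c : ℝ) (S : Set (EdgeConfig n)) : ℝ :=
  (∑ τ ∈ Finset.univ.filter (fun τ : EdgeConfig n => τ ∈ S), weight a b c τ) /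
    Zsum n a b c

/-- The four edges (bottom, right, top, left) of the unit square of `ℤ²`
whose lower-left corner is the `Λ_n`-vertex `(i, j)`. -/
def squareEdges (n : ℕ) (i j : ℕ) (hi : i + 1 < n) (hj : j + 1 < n) :
    Edge n × Edge n × Edge n × Edge n :=
  (Edge.horiz ⟨i + 1, by omega⟩ ⟨j, by omega⟩,
    Edge.vert ⟨i + 1, by omega⟩ ⟨j + 1, by omega⟩,
    Edge.horiz ⟨i + 1, by omega⟩ ⟨j + 1, by omega⟩,
    Edge.vert ⟨i, by omega⟩ ⟨j + 1, by omega⟩)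

/-- The four edges (bottom, right, top, left) around a unit square form a
directed cycle, i.e. are consistently oriented. -/
def DirectedSquare {n : ℕ} (τ : EdgeConfig n)
    (e : Edge n × Edge n × Edge n × Edge n) : Prop :=
  (τ e.1 = true ∧ τ e.2.1 = true ∧ τ e.2.2.1 = false ∧ τ e.2.2.2 = false) ∨
    (τ e.1 = false ∧ τ e.2.1 = false ∧ τ e.2.2.1 = true ∧ τ e.2.2.2 = true)

/-- Reversing the orientations of the four edges around a unit square. -/
def flipSquare {n : ℕ} (τ : EdgeConfig n)
    (e : Edge n × Edge n × Edge n × Edge n) : EdgeConfig n :=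
  fun f => if f = e.1 ∨ f = e.2.1 ∨ f = e.2.2.1 ∨ f = e.2.2.2 then !(τ f) else τ f

/-- A move of the Glauber dynamics `M_G` at the unit square with lower-left
corner `(i, j)`: the four edges around the square are consistently oriented
in `τ`, and `τ'` is obtained from `τ` by reversing them. -/
def GlauberMoveAt {n : ℕ} (τ τ' : EdgeConfig n) (i j : ℕ)
    (hi : i + 1 < n) (hj : j + 1 < n) : Prop :=
  DirectedSquare τ (squareEdges n i j hi hj) ∧
    τ' = flipSquare τ (squareEdges n i j hi hj)

/-- A move of the Glauber dynamics `M_G`. -/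
def GlauberMove {n : ℕ} (τ τ' : EdgeConfig n) : Prop :=
  ∃ (i j : ℕ) (hi : i + 1 < n) (hj : j + 1 < n), GlauberMoveAt τ τ' i j hi hj

/-- `∂C_G`: the states outside `C_G` that are one move of `M_G` away from
`C_G`. -/
def boundaryCG (n : ℕ) : Set (EdgeConfig n) :=
  {τ | IceRule τ ∧ τ ∉ CG n ∧ ∃ σ ∈ CG n, GlauberMove σ τ}

/-- The state space `Ω` as a type. -/
abbrev OmegaT (n : ℕ) := {τ : EdgeConfig n // IceRule τ}

open Classical in
/-- Metropolis transition rate of `M_G` between two distinct states: propose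
one of the `(n-1)²` unit squares uniformly at random and accept the flip with
probability `min 1 (w(τ')/w(τ))`. -/
noncomputable def metro {n : ℕ} (a b c : ℝ) (τ τ' : OmegaT n) : ℝ :=
  if GlauberMove τ.1 τ'.1 then
    (1 / (((n : ℝ) - 1) * ((n : ℝ) - 1))) *
      min 1 (weight a b c τ'.1 / weight a b c τ.1)
  else 0

/-- The transition matrix of the Glauber dynamics `M_G`. -/
noncomputable def transP {n : ℕ} (a b c : ℝ) (τ τ' : OmegaT n) : ℝ :=
  if τ' = τ then 1 - ∑ σ ∈ Finset.univ.erase τ, metro a b c τ σ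
  else metro a b c τ τ'

/-- The `t`-step transition probabilities of `M_G`. -/
noncomputable def transPow {n : ℕ} (a b c : ℝ) : ℕ → OmegaT n → OmegaT n → ℝ
  | 0, τ, τ' => if τ = τ' then 1 else 0
  | t + 1, τ, τ' => ∑ σ : OmegaT n, transPow a b c t τ σ * transP a b c σ τ'

/-- The stationary Gibbs distribution `π` on `Ω`. -/
noncomputable def piDist {n : ℕ} (a b c : ℝ) (τ : OmegaT n) : ℝ :=
  weight a b c τ.1 / Zsum n a b c

/-- Total variation distance between two distributions on `Ω`. -/
noncomputable def tvDist {n : ℕ} (μ ν : OmegaT n → ℝ) : ℝ :=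
  (∑ τ : OmegaT n, |μ τ - ν τ|) / 2

/-- The mixing time of `M_G`: the smallest `t` after which the total variation
distance to `π` is at most `1/4` from any starting state. -/
noncomputable def mixingTime (n : ℕ) (a b c : ℝ) : ℕ :=
  sInf {t : ℕ | ∀ τ₀ : OmegaT n,
    tvDist (transPow a b c t τ₀) (piDist a b c) ≤ 1 / 4}

/-- The number of green edges incident to the vertex `(i, j)` in `τ`. -/
def greenCountAt {n : ℕ} (τ : EdgeConfig n) (i j : Fin n) : ℕ :=
  (cond (greenB τ (leftE i j)) 1 0) + (cond (greenB τ (rightE i j)) 1 0) +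
    (cond (greenB τ (botE i j)) 1 0) + (cond (greenB τ (topE i j)) 1 0)

/-- The number of `L_τ`-edges incident to the `L_n`-vertex `u`. -/
def lTauDegree {n : ℕ} (τ : EdgeConfig n) (u : LVertex n) : ℕ :=
  (Finset.univ.filter (fun e : LEdge n =>
    lTau τ e = true ∧ ((lEdgeEnds e).1 = u ∨ (lEdgeEnds e).2 = u))).card

/-- The number of colour changes encountered when going rotationally
(bottom, right, top, left) around the four `Λ_n`-edges surrounding the
internal `L_n`-vertex `(i, j)` (representing the point `(i - 1/2, j - 1/2)`). -/
def colorChangesAround (n : ℕ) (τ : EdgeConfig n) (i j : ℕ)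
    (hi0 : 0 < i) (hin : i < n) (hj0 : 0 < j) (hjn : j < n) : ℕ :=
  let bo := greenB τ (Edge.horiz ⟨i, by omega⟩ ⟨j - 1, by omega⟩)
  let t := greenB τ (Edge.horiz ⟨i, by omega⟩ ⟨j, by omega⟩)
  let l := greenB τ (Edge.vert ⟨i - 1, by omega⟩ ⟨j, by omega⟩)
  let r := greenB τ (Edge.vert ⟨i, by omega⟩ ⟨j, by omega⟩)
  (cond (bo != r) 1 0) + (cond (r != t) 1 0) +
    (cond (t != l) 1 0) + (cond (l != bo) 1 0)

section Colours

variable {n : ℕ} {τ : EdgeConfig n}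

/-- At a vertex obeying the ice rule the four edges have the same colour, or one of the two
diagonals through the vertex separates the two green edges from the two red ones. -/
lemma IceRule.colours (hτ : IceRule τ) (i j : Fin n) :
    (greenB τ (leftE i j) = greenB τ (rightE i j) ∧ greenB τ (botE i j) = greenB τ (leftE i j) ∧
        greenB τ (topE i j) = greenB τ (leftE i j)) ∨
      (greenB τ (leftE i j) = greenB τ (botE i j) ∧ greenB τ (rightE i j) = greenB τ (topE i j) ∧
        greenB τ (leftE i j) ≠ greenB τ (rightE i j)) ∨
      (greenB τ (leftE i j) = greenB τ (topE i j) ∧ greenB τ (rightE i j) = greenB τ (botE i j) ∧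
        greenB τ (leftE i j) ≠ greenB τ (rightE i j)) := by
  have h := hτ i j
  unfold inDegree at h
  have hl : greenOrient (leftE i j) = ((i.val + j.val) % 2 == 0) := rfl
  have hr : greenOrient (rightE i j) = ((i.val + 1 + j.val) % 2 == 0) := rfl
  have hb : greenOrient (botE i j) = ((i.val + j.val) % 2 == 1) := rfl
  have ht : greenOrient (topE i j) = ((i.val + (j.val + 1)) % 2 == 1) := rfl
  unfold greenB
  rw [hl, hr, hb, ht]
  generalize τ (leftE i j) = l at *
  generalize τ (rightE i j) = r at *
  generalize τ (botE i j) = b at *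
  generalize τ (topE i j) = t at *
  rcases Nat.mod_two_eq_zero_or_one (i.val + j.val) with hp | hp
  · have h1 : (i.val + 1 + j.val) % 2 = 1 := by omega
    have h2 : (i.val + (j.val + 1)) % 2 = 1 := by omega
    rw [hp, h1, h2]
    revert h
    cases l <;> cases r <;> cases b <;> cases t <;> decide
  · have h1 : (i.val + 1 + j.val) % 2 = 0 := by omega
    have h2 : (i.val + (j.val + 1)) % 2 = 0 := by omega
    rw [hp, h1, h2]
    revert h
    cases l <;> cases r <;> cases b <;> cases t <;> decide

lemma edgeIncident_iff {e : Edge n} {i j : Fin n} :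
    EdgeIncident e (i, j) ↔ e = leftE i j ∨ e = rightE i j ∨ e = botE i j ∨ e = topE i j := by
  cases e <;> simp [EdgeIncident, leftE, rightE, botE, topE] <;> tauto

lemma EdgeAdj.symm {e f : Edge n} (h : EdgeAdj e f) : EdgeAdj f e :=
  ⟨h.1.symm, h.2.imp fun _ hv => hv.symm⟩

/-- The graph joining adjacent edges of `Λ_n` of the same colour. -/
def monoGraph (τ : EdgeConfig n) : SimpleGraph (Edge n) where
  Adj e f := EdgeAdj e f ∧ greenB τ e = greenB τ f
  symm := ⟨fun _ _ h => ⟨h.1.symm, h.2.symm⟩⟩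
  loopless := ⟨fun _ h => h.1.1 rfl⟩

/-- The graph with edge set `L_τ`. -/
def faultGraph (τ : EdgeConfig n) : SimpleGraph (LVertex n) where
  Adj := LStep τ
  symm := ⟨fun _ _ ⟨e, he, h⟩ => ⟨e, he.symm, h⟩⟩
  loopless := ⟨by
    rintro u ⟨⟨⟨i, j⟩, d⟩, he, -⟩
    cases d <;> rcases he with he | he <;>
      simp only [lEdgeEnds, Prod.ext_iff, Fin.ext_iff, Fin.val_succ, Fin.val_castSucc] at he <;>
      omega⟩

lemma SimpleGraph.Reachable.exists_nodup_isChain {V : Type*} {G : SimpleGraph V} {u v : V}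
    (h : G.Reachable u v) :
    ∃ p : List V, p ≠ [] ∧ p.Nodup ∧ p.IsChain G.Adj ∧ p.head? = some u ∧
      p.getLast? = some v ∧ ∀ w ∈ p, G.Reachable u w := by
  classical
  obtain ⟨w⟩ := h
  let q := w.toPath
  refine ⟨q.1.support, q.1.support_ne_nil, q.2.support_nodup, q.1.isChain_adj_support, ?_, ?_, ?_⟩
  · rw [List.head?_eq_some_head q.1.support_ne_nil, q.1.head_support]
  · rw [List.getLast?_eq_some_getLast q.1.support_ne_nil, q.1.getLast_support]
  · exact fun x hx => ⟨q.1.takeUntil x hx⟩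

lemma SimpleGraph.reachable_of_isChain {V : Type*} {G : SimpleGraph V} :
    ∀ {p : List V} {u v : V}, p.IsChain G.Adj → p.head? = some u → p.getLast? = some v →
      G.Reachable u v
  | [], _, _, _, hu, _ => by simp at hu
  | [a], u, v, _, hu, hv => by simp_all
  | a :: b :: l, u, v, h, hu, hv => by
    rw [List.isChain_cons_cons] at h
    obtain rfl : a = u := by simpa using hu
    exact h.1.reachable.trans
      (SimpleGraph.reachable_of_isChain h.2 rfl (by simpa using hv))

lemma greenB_eq_of_reachable {e f : Edge n} (h : (monoGraph τ).Reachable e f) :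
    greenB τ f = greenB τ e := by
  rw [SimpleGraph.reachable_iff_reflTransGen] at h
  induction h with
  | refl => rfl
  | tail _ h ih => rw [← h.2, ih]

lemma exists_monoPath {e f : Edge n} (h : (monoGraph τ).Reachable e f) :
    ∃ p, MonoPath τ (greenB τ e) p ∧ p.head? = some e ∧ p.getLast? = some f := by
  obtain ⟨p, h0, h1, h2, h3, h4, h5⟩ := h.exists_nodup_isChain
  exact ⟨p, ⟨h0, h1, h2.imp fun _ _ h => h.1, fun x hx => greenB_eq_of_reachable (h5 x hx)⟩, h3, h4⟩

lemma MonoPath.reachable {g : Bool} {p : List (Edge n)} {e f : Edge n} (h : MonoPath τ g p)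
    (he : p.head? = some e) (hf : p.getLast? = some f) : (monoGraph τ).Reachable e f := by
  refine SimpleGraph.reachable_of_isChain ?_ he hf
  have h2 : p.IsChain EdgeAdj := h.2.2.1
  refine List.IsChain.imp_of_mem_imp ?_ h2
  exact fun x y hx hy hxy => ⟨hxy, (h.2.2.2 x hx).trans (h.2.2.2 y hy).symm⟩

end Colours

section Flows

variable {n : ℕ}

/-- The sum modulo two of an edge function around a vertex. -/
def divergence (W : Edge n → ZMod 2) (i j : Fin n) : ZMod 2 :=
  W (leftE i j) + W (rightE i j) + (W (botE i j) + W (topE i j))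

/-- The sum modulo two of the values of `c` on the two sides of an edge. -/
def jump (c : LVertex n → ZMod 2) : Edge n → ZMod 2
  | Edge.horiz k j => c (k, j.castSucc) + c (k, j.succ)
  | Edge.vert i k => c (i.castSucc, k) + c (i.succ, k)

lemma sum_castSucc_add_succ (f : Fin (n + 1) → ZMod 2) :
    ∑ i : Fin n, (f i.castSucc + f i.succ) = f 0 + f (Fin.last n) := by
  have h1 := Fin.sum_univ_castSucc f
  have h2 := Fin.sum_univ_succ f
  rw [Finset.sum_add_distrib]
  linear_combination -h1 - h2 + (∑ i, f i - f 0 - f (Fin.last n)) *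
    CharTwo.two_eq_zero (R := ZMod 2)

lemma boundary_flux_eq_zero {W : Edge n → ZMod 2} (hW : ∀ i j, divergence W i j = 0) :
    ∑ j, (W (Edge.horiz 0 j) + W (Edge.horiz (Fin.last n) j)) +
      ∑ i, (W (Edge.vert i 0) + W (Edge.vert i (Fin.last n))) = 0 := by
  have hh : ∀ j, W (Edge.horiz 0 j) + W (Edge.horiz (Fin.last n) j) =
      ∑ i : Fin n, (W (leftE i j) + W (rightE i j)) := fun j =>
    (sum_castSucc_add_succ fun k => W (Edge.horiz k j)).symm
  have hv : ∀ i, W (Edge.vert i 0) + W (Edge.vert i (Fin.last n)) =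
      ∑ j : Fin n, (W (botE i j) + W (topE i j)) := fun i =>
    (sum_castSucc_add_succ fun k => W (Edge.vert i k)).symm
  simp only [hh, hv]
  rw [Finset.sum_comm, ← Finset.sum_add_distrib]
  refine Finset.sum_eq_zero fun i _ => ?_
  rw [← Finset.sum_add_distrib]
  exact Finset.sum_eq_zero fun j _ => hW i j

/-- A function constant on colour clusters times the jump of a function constant on the components
of `L_τ` is divergence free. -/
lemma divergence_mul_jump {τ : EdgeConfig n} (hτ : IceRule τ) {b : Edge n → ZMod 2}
    {c : LVertex n → ZMod 2} (hb : ∀ e f, (monoGraph τ).Adj e f → b e = b f)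
    (hc : ∀ u v, LStep τ u v → c u = c v) (i j : Fin n) :
    divergence (fun e => b e * jump c e) i j = 0 := by
  have hb' : ∀ e f, EdgeIncident e (i, j) → EdgeIncident f (i, j) → greenB τ e = greenB τ f →
      b e = b f := by
    intro e f he hf h
    by_cases hef : e = f
    · rw [hef]
    · exact hb _ _ ⟨⟨hef, _, he, hf⟩, h⟩
  have two : (2 : ZMod 2) = 0 := CharTwo.two_eq_zero
  have il : EdgeIncident (leftE i j) (i, j) := by simp [edgeIncident_iff]
  have ir : EdgeIncident (rightE i j) (i, j) := by simp [edgeIncident_iff]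
  have ib : EdgeIncident (botE i j) (i, j) := by simp [edgeIncident_iff]
  have it : EdgeIncident (topE i j) (i, j) := by simp [edgeIncident_iff]
  have jl : jump c (leftE i j) = c (i.castSucc, j.castSucc) + c (i.castSucc, j.succ) := rfl
  have jr : jump c (rightE i j) = c (i.succ, j.castSucc) + c (i.succ, j.succ) := rfl
  have jb : jump c (botE i j) = c (i.castSucc, j.castSucc) + c (i.succ, j.castSucc) := rfl
  have jt : jump c (topE i j) = c (i.castSucc, j.succ) + c (i.succ, j.succ) := rfl
  simp only [divergence, jl, jr, jb, jt]
  rcases hτ.colours i j with ⟨h1, h2, h3⟩ | ⟨h1, h2, h3⟩ | ⟨h1, h2, h3⟩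
  · rw [← hb' _ _ il ir h1, hb' _ _ ib il h2, hb' _ _ it il h3]
    linear_combination b (leftE i j) * (c (i.castSucc, j.castSucc) + c (i.castSucc, j.succ) +
      c (i.succ, j.castSucc) + c (i.succ, j.succ)) * two
  · have hd : c (i.succ, j.castSucc) = c (i.castSucc, j.succ) :=
      hc _ _ ⟨((i, j), false), Or.inl rfl, by simp [lTau, ← h1, ← h2, h3]⟩
    rw [← hb' _ _ il ib h1, hb' _ _ ir it h2, hd]
    linear_combination (b (leftE i j) * (c (i.castSucc, j.castSucc) + c (i.castSucc, j.succ)) +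
      b (topE i j) * (c (i.castSucc, j.succ) + c (i.succ, j.succ))) * two
  · have hd : c (i.castSucc, j.castSucc) = c (i.succ, j.succ) :=
      hc _ _ ⟨((i, j), true), Or.inl rfl, by simp [lTau, ← h1, ← h2, h3]⟩
    rw [← hb' _ _ il it h1, hb' _ _ ir ib h2, hd]
    linear_combination (b (leftE i j) * (c (i.castSucc, j.succ) + c (i.succ, j.succ)) +
      b (botE i j) * (c (i.succ, j.castSucc) + c (i.succ, j.succ))) * two

end Flows

section Duality

variable {n : ℕ} {τ : EdgeConfig n}

open Classical in
/-- The indicator of the set of vertices reachable in `G` from a point of `S`. -/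
noncomputable def reachIndicator {V : Type*} (G : SimpleGraph V) (S : Set V) (v : V) : ZMod 2 :=
  if ∃ u ∈ S, G.Reachable u v then 1 else 0

lemma reachIndicator_eq_of_adj {V : Type*} {G : SimpleGraph V} (S : Set V) {u v : V}
    (h : G.Adj u v) : reachIndicator G S u = reachIndicator G S v := by
  have : (∃ w ∈ S, G.Reachable w u) ↔ ∃ w ∈ S, G.Reachable w v :=
    exists_congr fun w => and_congr_right fun _ =>
      ⟨fun hw => hw.trans h.reachable, fun hw => hw.trans h.symm.reachable⟩
  unfold reachIndicator
  split_ifs with hu hv hv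
  · rfl
  · exact absurd (this.1 hu) hv
  · exact absurd (this.2 hv) hu
  · rfl

lemma reachIndicator_of_mem {V : Type*} {G : SimpleGraph V} {S : Set V} {v : V} (h : v ∈ S) :
    reachIndicator G S v = 1 :=
  if_pos ⟨v, h, SimpleGraph.Reachable.refl v⟩

lemma exists_horizBridge_of_not_hasVertFaultLine (hτ : IceRule τ) (h : ¬ HasVertFaultLine τ) :
    ∃ g p, IsHorizBridge τ g p := by
  by_contra hno
  let b := reachIndicator (monoGraph τ) (Set.range (Edge.horiz 0))
  let c := reachIndicator (faultGraph τ) {u | u.2 = Fin.last n}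
  have hb0 : ∀ j, b (Edge.horiz 0 j) = 1 := fun j => reachIndicator_of_mem ⟨j, rfl⟩
  have hb1 : ∀ j, b (Edge.horiz (Fin.last n) j) = 0 := by
    refine fun j => if_neg ?_
    rintro ⟨_, ⟨k, rfl⟩, hk⟩
    obtain ⟨p, hp, h0, h1⟩ := exists_monoPath hk
    exact hno ⟨_, p, hp, ⟨k, h0⟩, ⟨j, h1⟩⟩
  have hc1 : ∀ i, c (i, Fin.last n) = 1 := fun i => reachIndicator_of_mem rfl
  have hc0 : ∀ i, c (i, 0) = 0 := by
    refine fun i => if_neg ?_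
    rintro ⟨u, hu, hr⟩
    obtain ⟨p, h0, h1, h2, h3, h4, -⟩ := hr.exists_nodup_isChain
    exact h ⟨p, h0, h1, h2, ⟨u, h3, hu⟩, ⟨_, h4, rfl⟩⟩
  have hflux := boundary_flux_eq_zero (divergence_mul_jump hτ (b := b) (c := c)
    (fun _ _ => reachIndicator_eq_of_adj _)
    (fun _ _ huv => reachIndicator_eq_of_adj (G := faultGraph τ) _ huv))
  have htel := sum_castSucc_add_succ fun k => c (0, k)
  simp [jump, hb0, hb1, hc0, hc1, CharTwo.add_self_eq_zero, htel] at hflux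

lemma exists_vertBridge_of_not_hasHorizFaultLine (hτ : IceRule τ) (h : ¬ HasHorizFaultLine τ) :
    ∃ g p, IsVertBridge τ g p := by
  by_contra hno
  let b := reachIndicator (monoGraph τ) (Set.range fun i => Edge.vert i (Fin.last n))
  let c := reachIndicator (faultGraph τ) {u | u.1 = 0}
  have hb0 : ∀ i, b (Edge.vert i (Fin.last n)) = 1 := fun i => reachIndicator_of_mem ⟨i, rfl⟩
  have hb1 : ∀ i, b (Edge.vert i 0) = 0 := by
    refine fun i => if_neg ?_
    rintro ⟨_, ⟨k, rfl⟩, hk⟩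
    obtain ⟨p, hp, h0, h1⟩ := exists_monoPath hk
    exact hno ⟨_, p, hp, ⟨k, h0⟩, ⟨i, h1⟩⟩
  have hc1 : ∀ j, c (0, j) = 1 := fun j => reachIndicator_of_mem rfl
  have hc0 : ∀ j, c (Fin.last n, j) = 0 := by
    refine fun j => if_neg ?_
    rintro ⟨u, hu, hr⟩
    obtain ⟨p, h0, h1, h2, h3, h4, -⟩ := hr.exists_nodup_isChain
    exact h ⟨p, h0, h1, h2, ⟨u, h3, hu⟩, ⟨_, h4, rfl⟩⟩
  have hflux := boundary_flux_eq_zero (divergence_mul_jump hτ (b := b) (c := c)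
    (fun _ _ => reachIndicator_eq_of_adj _)
    (fun _ _ huv => reachIndicator_eq_of_adj (G := faultGraph τ) _ huv))
  have htel := sum_castSucc_add_succ fun k => c (k, Fin.last n)
  simp [jump, hb0, hb1, hc0, hc1, CharTwo.add_self_eq_zero, htel] at hflux

end Duality

section Crossing

variable {n : ℕ} {τ : EdgeConfig n}

/-- A flow modulo two along edges of colour `g`, of total flux one through the top boundary and
avoiding the left and right boundaries, whose divergence is `d`. -/
structure IsTopFlow (τ : EdgeConfig n) (g : Bool) (d : Fin n × Fin n → ZMod 2)
    (N : Edge n → ZMod 2) : Prop where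
  colour : ∀ e, greenB τ e ≠ g → N e = 0
  left : ∀ j, N (Edge.horiz 0 j) = 0
  right : ∀ j, N (Edge.horiz (Fin.last n) j) = 0
  top : ∑ i, N (Edge.vert i (Fin.last n)) = 1
  div : ∀ i j, divergence N i j = d (i, j)

open Classical in
lemma divergence_single (e : Edge n) (i j : Fin n) :
    divergence (Pi.single e 1) i j = if EdgeIncident e (i, j) then 1 else 0 := by
  have h1 : i.castSucc ≠ i.succ := (Fin.castSucc_lt_succ).ne
  have h2 : j.castSucc ≠ j.succ := (Fin.castSucc_lt_succ).ne
  rcases e with ⟨k, l⟩ | ⟨k, l⟩ <;>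
    simp only [divergence, leftE, rightE, botE, topE, Pi.single_apply, EdgeIncident,
      Edge.horiz.injEq, Edge.vert.injEq, reduceCtorEq, if_false] <;> grind


lemma divergence_add (N M : Edge n → ZMod 2) (i j : Fin n) :
    divergence (N + M) i j = divergence N i j + divergence M i j := by
  simp only [divergence, Pi.add_apply]
  ring

lemma eq_of_incident_boundary {e : Edge n} {v w : Fin n × Fin n}
    (he : (∃ j, e = Edge.horiz 0 j) ∨ (∃ j, e = Edge.horiz (Fin.last n) j) ∨
      (∃ i, e = Edge.vert i 0) ∨ ∃ i, e = Edge.vert i (Fin.last n))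
    (hv : EdgeIncident e v) (hw : EdgeIncident e w) : v = w := by
  obtain ⟨a, b⟩ := v
  obtain ⟨c, d⟩ := w
  rcases he with ⟨k, rfl⟩ | ⟨k, rfl⟩ | ⟨k, rfl⟩ | ⟨k, rfl⟩ <;>
    simp only [EdgeIncident, Fin.ext_iff, Fin.val_succ, Fin.val_castSucc, Fin.val_zero,
      Fin.val_last, Prod.mk.injEq] at hv hw ⊢ <;> omega

lemma incident_iff_of_ne {e : Edge n} {u v w : Fin n × Fin n} (hv : EdgeIncident e v)
    (hw : EdgeIncident e w) (hvw : v ≠ w) : EdgeIncident e u ↔ u = v ∨ u = w := by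
  obtain ⟨a, b⟩ := v
  obtain ⟨c, d⟩ := w
  obtain ⟨x, y⟩ := u
  cases e <;>
    simp only [EdgeIncident, Fin.ext_iff, Fin.val_succ, Fin.val_castSucc, ne_eq,
      Prod.mk.injEq] at hv hw hvw ⊢ <;> omega

lemma IsTopFlow.add_single {g : Bool} {d d' : Fin n × Fin n → ZMod 2} {N : Edge n → ZMod 2}
    (h : IsTopFlow τ g d N) {e : Edge n} (he : greenB τ e = g) (hl : ∀ j, e ≠ Edge.horiz 0 j)
    (hr : ∀ j, e ≠ Edge.horiz (Fin.last n) j) (ht : ∀ i, e ≠ Edge.vert i (Fin.last n))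
    (hd : ∀ i j, d (i, j) + divergence (Pi.single e 1) i j = d' (i, j)) :
    IsTopFlow τ g d' (N + Pi.single e 1) where
  colour f hf := by
    have : f ≠ e := by rintro rfl; exact hf he
    simp [h.colour f hf, this]
  left j := by simp [h.left j, (hl j).symm]
  right j := by simp [h.right j, (hr j).symm]
  top := by simp [(ht _).symm, h.top]
  div i j := by rw [divergence_add, h.div, hd]

lemma exists_topFlow_to_vertex {g : Bool} {i : Fin n} {e : Edge n}
    (hg : greenB τ (Edge.vert i (Fin.last n)) = g)
    (h : (monoGraph τ).Reachable (Edge.vert i (Fin.last n)) e) :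
    ∀ v, EdgeIncident e v → ∃ N, IsTopFlow τ g (Pi.single v 1) N := by
  classical
  have hcol := greenB_eq_of_reachable h
  rw [SimpleGraph.reachable_iff_reflTransGen] at h
  induction h with
  | refl =>
    intro v hv
    refine ⟨Pi.single (Edge.vert i (Fin.last n)) 1, ?_, ?_, ?_, ?_, ?_⟩
    · intro f hf
      have : f ≠ Edge.vert i (Fin.last n) := by rintro rfl; exact hf hg
      simp [this]
    · simp
    · simp
    · simp [Pi.single_apply]
    · intro a b
      rw [divergence_single, Pi.single_apply]
      refine if_congr ⟨fun hab => ?_, fun hab => hab ▸ hv⟩ rfl rfl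
      exact eq_of_incident_boundary (Or.inr (Or.inr (Or.inr ⟨i, rfl⟩))) hab hv
  | @tail e f hr hef ih =>
    intro w hw
    obtain ⟨⟨-, v, hve, hvf⟩, hc⟩ := hef
    obtain ⟨N, hN⟩ := ih (hc.trans hcol) v hve
    by_cases hvw : v = w
    · exact ⟨N, hvw ▸ hN⟩
    · refine ⟨_, hN.add_single (e := f) (hcol.trans hg) ?_ ?_ ?_ fun a b => ?_⟩
      · exact fun j hj => hvw (eq_of_incident_boundary (Or.inl ⟨j, hj⟩) hvf hw)
      · exact fun j hj => hvw (eq_of_incident_boundary (Or.inr (Or.inl ⟨j, hj⟩)) hvf hw)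
      · exact fun j hj => hvw (eq_of_incident_boundary (Or.inr (Or.inr (Or.inr ⟨j, hj⟩))) hvf hw)
      · rw [divergence_single, incident_iff_of_ne hvf hw hvw, Pi.single_apply, Pi.single_apply]
        by_cases h1 : (a, b) = v
        · simp [h1, hvw, CharTwo.add_self_eq_zero]
        · simp [h1]

lemma IsVertBridge.exists_topFlow {g : Bool} {p : List (Edge n)} (hp : IsVertBridge τ g p) :
    ∃ N, IsTopFlow τ g 0 N := by
  classical
  obtain ⟨hm, ⟨i, hi⟩, ⟨k, hk⟩⟩ := hp
  have hn : 0 < n := k.pos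
  have hv : EdgeIncident (Edge.vert k 0) (k, (⟨0, hn⟩ : Fin n)) := ⟨rfl, Or.inl rfl⟩
  obtain ⟨N, hN⟩ := exists_topFlow_to_vertex (hm.2.2.2 _ (List.mem_of_mem_head? hi))
    (hm.reachable hi hk) _ hv
  refine ⟨_, hN.add_single (hm.2.2.2 _ (List.mem_of_mem_getLast? hk)) (by simp) (by simp) ?_
    fun a b => ?_⟩
  · intro j hj
    simp only [Edge.vert.injEq, Fin.ext_iff, Fin.val_zero, Fin.val_last] at hj
    omega
  · rw [divergence_single, Pi.single_apply, ← if_congr (P := EdgeIncident (Edge.vert k 0) (a, b))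
      ⟨fun h => eq_of_incident_boundary (Or.inr (Or.inr (Or.inl ⟨k, rfl⟩))) h hv,
        fun h => h ▸ hv⟩ rfl rfl]
    exact CharTwo.add_self_eq_zero _

/-- A potential for a divergence-free flow modulo two that avoids the left boundary. -/
def potential (N : Edge n → ZMod 2) (u : LVertex n) : ZMod 2 :=
  ∑ i : Fin n, if i.castSucc < u.1 then N (Edge.vert i u.2) else 0

lemma potential_zero (N : Edge n → ZMod 2) (k : Fin (n + 1)) : potential N (0, k) = 0 := by
  simp [potential]

lemma potential_succ (N : Edge n → ZMod 2) (i : Fin n) (k : Fin (n + 1)) :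
    potential N (i.succ, k) = potential N (i.castSucc, k) + N (Edge.vert i k) := by
  have : N (Edge.vert i k) = ∑ a : Fin n, if a = i then N (Edge.vert a k) else 0 := by simp
  rw [potential, potential, this, ← Finset.sum_add_distrib]
  refine Finset.sum_congr rfl fun a _ => ?_
  simp only [Fin.lt_def, Fin.ext_iff, Fin.val_succ, Fin.val_castSucc]
  rcases lt_trichotomy a.val i.val with h | h | h
  · simp [h, h.ne, h.trans (Nat.lt_succ_self _)]
  · simp [h]
  · simp [h.ne', Nat.not_le.2 h, Nat.not_lt.2 h.le]

lemma potential_vert {N : Edge n → ZMod 2} (hl : ∀ j, N (Edge.horiz 0 j) = 0)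
    (hd : ∀ i j, divergence N i j = 0) (k : Fin (n + 1)) (j : Fin n) :
    potential N (k, j.succ) = potential N (k, j.castSucc) + N (Edge.horiz k j) := by
  induction k using Fin.induction with
  | zero => simp [potential_zero, hl]
  | succ i ih =>
    have h := hd i j
    simp only [divergence, leftE, rightE, botE, topE] at h
    rw [potential_succ, potential_succ, ih]
    linear_combination h - N (Edge.horiz i.succ j) * CharTwo.two_eq_zero (R := ZMod 2) -
      N (Edge.vert i j.castSucc) * CharTwo.two_eq_zero (R := ZMod 2)

/-- The value of the potential on the lower or left side of an edge. -/
def sideValue (φ : LVertex n → ZMod 2) : Edge n → ZMod 2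
  | Edge.horiz k j => φ (k, j.castSucc)
  | Edge.vert i k => φ (i.castSucc, k)

lemma IsTopFlow.sideValue_eq (hτ : IceRule τ) {g : Bool} {N : Edge n → ZMod 2}
    (hN : IsTopFlow τ g 0 N) {e f : Edge n} (hef : (monoGraph τ).Adj e f)
    (he : greenB τ e ≠ g) :
    sideValue (potential N) e = sideValue (potential N) f := by
  obtain ⟨⟨-, ⟨i, j⟩, hei, hfi⟩, hc⟩ := hef
  have hf : greenB τ f ≠ g := hc ▸ he
  have hd : ∀ i j, divergence N i j = 0 := fun i j => hN.div i j
  have hl := potential_vert hN.left hd i.castSucc j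
  have hr := potential_vert hN.left hd i.succ j
  have hb := potential_succ N i j.castSucc
  have ht := potential_succ N i j.succ
  have sl : sideValue (potential N) (leftE i j) = potential N (i.castSucc, j.castSucc) := rfl
  have sr : sideValue (potential N) (rightE i j) = potential N (i.succ, j.castSucc) := rfl
  have sb : sideValue (potential N) (botE i j) = potential N (i.castSucc, j.castSucc) := rfl
  have st : sideValue (potential N) (topE i j) = potential N (i.castSucc, j.succ) := rfl
  have zl := hN.colour (leftE i j)
  have zr := hN.colour (rightE i j)
  have zb := hN.colour (botE i j)
  have zt := hN.colour (topE i j)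
  have hice := hτ.colours i j
  rw [← leftE] at hl
  rw [← rightE] at hr
  rw [← botE] at hb
  rw [← topE] at ht
  rw [edgeIncident_iff] at hei hfi
  rcases hei with rfl | rfl | rfl | rfl <;> rcases hfi with rfl | rfl | rfl | rfl <;> grind

/-- A horizontal and a vertical monochromatic bridge have the same colour. -/
lemma IsHorizBridge.colour_eq (hτ : IceRule τ) {g g' : Bool} {p q : List (Edge n)}
    (hp : IsHorizBridge τ g p) (hq : IsVertBridge τ g' q) : g = g' := by
  by_contra hgg
  obtain ⟨N, hN⟩ := hq.exists_topFlow
  obtain ⟨hm, ⟨j, hj⟩, ⟨k, hk⟩⟩ := hp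
  have hd : ∀ i j, divergence N i j = 0 := fun i j => hN.div i j
  have hcol : greenB τ (Edge.horiz 0 j) = g := hm.2.2.2 _ (List.mem_of_mem_head? hj)
  have hinv : ∀ e, (monoGraph τ).Reachable (Edge.horiz 0 j) e →
      sideValue (potential N) e = 0 := by
    intro e he
    rw [SimpleGraph.reachable_iff_reflTransGen] at he
    induction he with
    | refl => exact potential_zero N _
    | @tail e f he hef ih =>
      rw [← SimpleGraph.reachable_iff_reflTransGen] at he
      rw [← hN.sideValue_eq hτ hef (by rw [greenB_eq_of_reachable he, hcol]; exact hgg), ih]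
  have hright : ∀ l : Fin (n + 1), potential N (Fin.last n, l) = 1 := by
    intro l
    induction l using Fin.reverseInduction with
    | last => simpa [potential, Fin.castSucc_lt_last] using hN.top
    | cast l ih => simpa [potential_vert hN.left hd, hN.right] using ih
  have h0 := hinv _ (hm.reachable hj hk)
  rw [sideValue, hright] at h0
  exact one_ne_zero h0

end Crossing

/-- a state with no monochromatic cross has a fault line. -/
theorem no_cross_fault_line (n : ℕ) (hn : 1 ≤ n)
    (τ : EdgeConfig n) (hτ : τ ∈ OmegaSet n)
    (hg : ¬ HasGreenCross τ) (hr : ¬ HasRedCross τ) :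
    HasHorizFaultLine τ ∨ HasVertFaultLine τ := by
  by_contra! h
  obtain ⟨g, p, hp⟩ := exists_horizBridge_of_not_hasVertFaultLine hτ h.2
  obtain ⟨g', q, hq⟩ := exists_vertBridge_of_not_hasHorizFaultLine hτ h.1
  obtain rfl := hp.colour_eq hτ hq
  cases g
  · exact hr ⟨⟨p, hp⟩, ⟨q, hq⟩⟩
  · exact hg ⟨⟨p, hp⟩, ⟨q, hq⟩⟩
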